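/- Chapman–Kolmogorov (semigroup) property of determinantal heat kernels: for all x, z : Fin N → ℤ, the family, indexed by strictly increasing tuples y_1 < ⋯ < y_N in ℤ, of the numbers det[K_t(x_i, y_j)]_{i,j=1}^{N} · det[K_s(y_i, z_j)]_{i,j=1}^{N} is summable, and its sum equals det[K_{t+s}(x_i, z_j)]_{i,j=1}^{N}. -/

import Mathlib

/-- The heat kernel `K_u(x, y) = Σ_l e^{u·m_l}·p_l(x)·p_l(y)`. -/
noncomputable def Kker (m : ℕ → ℝ) (p : ℕ → ℤ → ℝ) (u : ℝ) (x y : ℤ) : ℝ :=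
  ∑' l : ℕ, Real.exp (u * m l) * p l x * p l y

lemma hasSum_mul_real {ι κ : Type} {f : ι → ℝ} {g : κ → ℝ} {a b : ℝ}
    (hf : HasSum f a) (hg : HasSum g b) :
    HasSum (fun q : ι × κ => f q.1 * g q.2) (a * b) :=
  HasSum.mul hf hg (summable_mul_of_summable_norm (f := f) (g := g)
    hf.summable.norm hg.summable.norm)

lemma hasSum_pi_prod (N : ℕ) (f : Fin N → ℤ → ℝ) (a : Fin N → ℝ)
    (h : ∀ i, HasSum (f i) (a i)) :
    HasSum (fun y : Fin N → ℤ => ∏ i, f i (y i)) (∏ i, a i) := by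
  induction N with
  | zero =>
    simp
  | succ n ih =>
    have h1 := ih (fun i => f i.succ) (fun i => a i.succ) (fun i => h i.succ)
    have h2 := hasSum_mul_real (h 0) h1
    rw [← Equiv.hasSum_iff (Fin.consEquiv (fun _ : Fin (n + 1) => ℤ)), Fin.prod_univ_succ]
    convert h2 using 1
    funext y
    simp [Fin.prod_univ_succ, Fin.consEquiv]

lemma cauchyBinet_hasSum (N : ℕ) (A : Fin N → ℤ → ℝ) (B : ℤ → Fin N → ℝ)
    (C : Fin N → Fin N → ℝ) (h : ∀ i j, HasSum (fun w => A i w * B w j) (C i j)) :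
    HasSum (fun y : {y : Fin N → ℤ // StrictMono y} =>
      Matrix.det (Matrix.of fun i j => A i (y.1 j))
        * Matrix.det (Matrix.of fun i j => B (y.1 i) j))
      (Matrix.det (Matrix.of fun i j => C i j)) := by
  have h1 : HasSum (fun y : Fin N → ℤ =>
      Matrix.det (Matrix.of fun i j => A i (y j)) * ∏ i, B (y i) i)
      (Matrix.det (Matrix.of fun i j => C i j)) := by
    rw [Matrix.det_apply']
    have h2 := hasSum_sum (s := (Finset.univ : Finset (Equiv.Perm (Fin N))))
      (fun σ _ => (hasSum_pi_prod N (fun i w => A (σ i) w * B w i) (fun i => C (σ i) i)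
        (fun i => h (σ i) i)).mul_left (((Equiv.Perm.sign σ : ℤˣ) : ℤ) : ℝ))
    refine (congrArg (fun f => HasSum f _) (funext fun y => ?_)).mpr h2
    rw [Matrix.det_apply', Finset.sum_mul]
    refine Finset.sum_congr rfl fun σ _ => ?_
    simp only [Matrix.of_apply, Finset.prod_mul_distrib]
    ring
  let φ : {y : Fin N → ℤ // StrictMono y} × Equiv.Perm (Fin N) → (Fin N → ℤ) :=
    fun q => q.1.1 ∘ q.2
  have hφ : Function.Injective φ := by
    rintro ⟨⟨y, hy⟩, σ⟩ ⟨⟨y', hy'⟩, σ'⟩ he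
    have he' : y ∘ σ = y' ∘ σ' := he
    have hr : Set.range y = Set.range y' := by
      rw [← σ.surjective.range_comp y, he', σ'.surjective.range_comp y']
    obtain rfl := (StrictMono.range_inj hy hy').1 hr
    have : σ = σ' := by
      ext i
      exact congrArg _ (hy.injective (congrFun he' i))
    rw [this]
  have h0 : ∀ y ∉ Set.range φ,
      Matrix.det (Matrix.of fun i j => A i (y j)) * ∏ i, B (y i) i = 0 := by
    intro y hy
    have hinj : ¬ Function.Injective y := by
      intro hi
      apply hy
      refine ⟨(⟨y ∘ Tuple.sort y, (Tuple.monotone_sort y).strictMono_of_injective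
        (hi.comp (Tuple.sort y).injective)⟩, (Tuple.sort y)⁻¹), ?_⟩
      funext i
      simp [φ]
    rw [Function.not_injective_iff] at hinj
    obtain ⟨i, j, hij, hne⟩ := hinj
    rw [Matrix.det_zero_of_column_eq hne (by intro k; simp [hij]), zero_mul]
  have h3 := (hφ.hasSum_iff h0).2 h1
  refine h3.prod_fiberwise fun y => ?_
  convert hasSum_fintype _ using 1
  rw [Matrix.det_apply' (Matrix.of fun i j => B (y.1 i) j), Finset.mul_sum]
  refine Finset.sum_congr rfl fun σ _ => ?_
  have := Matrix.det_permute' σ (Matrix.of fun i j => A i (y.1 j))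
  have e : (Matrix.of fun i j => A i (φ (y, σ) j))
      = (Matrix.of fun i j => A i (y.1 j)).submatrix id σ := rfl
  simp only [Function.comp]
  rw [e, this]
  simp only [Matrix.of_apply, φ, Function.comp]
  ring

set_option maxHeartbeats 1000000 in
lemma kker_hasSum (p : ℕ → ℤ → ℝ)
    (horth : ∀ l l' : ℕ, HasSum (fun x : ℤ => p l x * p l' x) (if l = l' then 1 else 0))
    (m : ℕ → ℝ) (t s : ℝ)
    (hsum_t : Summable fun l : ℕ => Real.exp (t * m l))
    (hsum_s : Summable fun l : ℕ => Real.exp (s * m l)) (a b : ℤ) :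
    HasSum (fun w => Kker m p t a w * Kker m p s w b) (Kker m p (t + s) a b) := by
  have hp : ∀ l x, |p l x| ≤ 1 := by
    intro l x
    have h1 := le_hasSum (horth l l) x (fun y _ => mul_self_nonneg _)
    simp only [if_true] at h1
    exact abs_le_one_iff_mul_self_le_one.2 h1
  have hK : ∀ u, (Summable fun l : ℕ => Real.exp (u * m l)) → ∀ x y,
      Summable (fun l => Real.exp (u * m l) * p l x * p l y) := by
    intro u hu x y
    refine Summable.of_norm_bounded hu fun l => ?_
    rw [Real.norm_eq_abs, abs_mul, abs_mul, Real.abs_exp, mul_assoc]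
    exact mul_le_of_le_one_right (Real.exp_pos _).le
      (mul_le_one₀ (hp l x) (abs_nonneg _) (hp l y))
  let F : (ℕ × ℕ) × ℤ → ℝ := fun q =>
    (Real.exp (t * m q.1.1) * p q.1.1 a * p q.1.1 q.2) *
      (Real.exp (s * m q.1.2) * p q.1.2 q.2 * p q.1.2 b)
  let G : (ℕ × ℕ) × ℤ → ℝ := fun q =>
    (Real.exp (t * m q.1.1) * Real.exp (s * m q.1.2)) *
      ((p q.1.1 q.2 * p q.1.1 q.2 + p q.1.2 q.2 * p q.1.2 q.2) / 2)
  have hGf : ∀ r : ℕ × ℕ, HasSum (fun w => G (r, w))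
      (Real.exp (t * m r.1) * Real.exp (s * m r.2)) := by
    intro r
    have := (((horth r.1 r.1).add (horth r.2 r.2)).div_const 2).mul_left
      (Real.exp (t * m r.1) * Real.exp (s * m r.2))
    simpa [G] using this
  have hG : Summable G := by
    rw [summable_prod_of_nonneg]
    · refine ⟨fun r => (hGf r).summable, ?_⟩
      simp only [fun r => (hGf r).tsum_eq]
      exact summable_mul_of_summable_norm hsum_t.norm hsum_s.norm
    · intro q
      have h1 := mul_self_nonneg (p q.1.1 q.2)
      have h2 := mul_self_nonneg (p q.1.2 q.2)
      simp only [G, Pi.zero_apply]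
      positivity
  have hF : Summable F := by
    refine Summable.of_norm_bounded hG fun q => ?_
    have e : ‖F q‖ = (Real.exp (t * m q.1.1) * Real.exp (s * m q.1.2)) *
        ((|p q.1.1 a| * |p q.1.2 b|) * (|p q.1.1 q.2| * |p q.1.2 q.2|)) := by
      simp only [F, Real.norm_eq_abs, abs_mul, Real.abs_exp]
      ring
    rw [e]
    refine mul_le_mul_of_nonneg_left ?_ (by positivity)
    have h1 : |p q.1.1 a| * |p q.1.2 b| ≤ 1 :=
      mul_le_one₀ (hp _ _) (abs_nonneg _) (hp _ _)
    have h2 : 0 ≤ |p q.1.1 q.2| * |p q.1.2 q.2| := by positivity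
    have h3 := mul_le_of_le_one_left h2 h1
    have h4 := abs_mul_abs_self (p q.1.1 q.2)
    have h5 := abs_mul_abs_self (p q.1.2 q.2)
    nlinarith [mul_self_nonneg (|p q.1.1 q.2| - |p q.1.2 q.2|)]
  have hA := hF.hasSum
  have hA1 : HasSum (fun w => Kker m p t a w * Kker m p s w b) (∑' q, F q) := by
    have hsw : HasSum (fun q : ℤ × (ℕ × ℕ) => F (q.2, q.1)) (∑' q, F q) :=
      (Equiv.hasSum_iff (f := F) (Equiv.prodComm ℤ (ℕ × ℕ))).2 hA
    refine hsw.prod_fiberwise fun w => ?_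
    have h1 : HasSum (fun l => Real.exp (t * m l) * p l a * p l w) (Kker m p t a w) :=
      (hK t hsum_t a w).hasSum
    have h2 : HasSum (fun l => Real.exp (s * m l) * p l w * p l b) (Kker m p s w b) :=
      (hK s hsum_s w b).hasSum
    exact hasSum_mul_real h1 h2
  have hA2 : HasSum (fun r : ℕ × ℕ => (Real.exp (t * m r.1) * p r.1 a) *
      (Real.exp (s * m r.2) * p r.2 b) * (if r.1 = r.2 then 1 else 0)) (∑' q, F q) := by
    refine hA.prod_fiberwise fun r => ?_
    have h2 := (horth r.1 r.2).mul_left ((Real.exp (t * m r.1) * p r.1 a) *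
      (Real.exp (s * m r.2) * p r.2 b))
    refine (congrArg (fun f => HasSum f _) (funext fun w => ?_)).mpr h2
    simp only [F]
    ring
  have hA3 : HasSum (fun l => Real.exp ((t + s) * m l) * p l a * p l b) (∑' q, F q) := by
    refine hA2.prod_fiberwise fun l => ?_
    convert hasSum_single l ?_ using 1
    · simp only [if_true, add_mul, Real.exp_add]
      ring
    · intro l' hl
      simp [hl.symm]
  have : Kker m p (t + s) a b = ∑' q, F q := hA3.tsum_eq
  rw [this]
  exact hA1

/-- Chapman–Kolmogorov (semigroup) property of determinantal heat kernels: for an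
orthonormal family `(p_l)` in `ℓ²(ℤ;ℝ)` and `t, s > 0` with `Σ_l e^{t·m_l} < ∞`,
`Σ_l e^{s·m_l} < ∞`, the family `det[K_t(x_i, y_j)]·det[K_s(y_i, z_j)]`, indexed by
strictly increasing tuples `y₁ < ⋯ < y_N`, is summable with sum `det[K_{t+s}(x_i, z_j)]`. -/
theorem chapman_kolmogorov (N : ℕ) (hN : 1 ≤ N) (p : ℕ → ℤ → ℝ)
    (horth : ∀ l l' : ℕ, HasSum (fun x : ℤ => p l x * p l' x) (if l = l' then 1 else 0))
    (m : ℕ → ℝ) (t s : ℝ) (ht : 0 < t) (hs : 0 < s)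
    (hsum_t : Summable fun l : ℕ => Real.exp (t * m l))
    (hsum_s : Summable fun l : ℕ => Real.exp (s * m l))
    (x z : Fin N → ℤ) :
    Summable (fun y : {y : Fin N → ℤ // StrictMono y} =>
      Matrix.det (Matrix.of fun i j => Kker m p t (x i) (y.1 j))
        * Matrix.det (Matrix.of fun i j => Kker m p s (y.1 i) (z j))) ∧
    ∑' y : {y : Fin N → ℤ // StrictMono y},
        Matrix.det (Matrix.of fun i j => Kker m p t (x i) (y.1 j))
          * Matrix.det (Matrix.of fun i j => Kker m p s (y.1 i) (z j))
      = Matrix.det (Matrix.of fun i j => Kker m p (t + s) (x i) (z j)) := by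
  have h := cauchyBinet_hasSum N (fun i w => Kker m p t (x i) w)
    (fun w j => Kker m p s w (z j)) (fun i j => Kker m p (t + s) (x i) (z j))
    (fun i j => kker_hasSum p horth m t s hsum_t hsum_s (x i) (z j))
  exact ⟨h.summable, h.tsum_eq⟩
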